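/- Let M₁, M₂ be finite sets with |M₂| ≥ 2, let ℱ be a set of functions M₁ → M₂, and let c > 0 satisfy |ℱ| ≤ |M₂|^c. Then there exists a function g : M₁ → M₂ such that for every f ∈ ℱ, the number of x ∈ M₁ with f(x) = g(x) is at most max{e²·|M₁|/|M₂|, c·log|M₂| + log|M₁|}. -/

import Mathlib

lemma exp_mul_ncard_agree {α β : Type*} [Fintype α] [DecidableEq β] (t : ℝ) (f g : α → β) :
    Real.exp (t * (Set.ncard {x | f x = g x} : ℝ)) =
      ∏ x, if f x = g x then Real.exp t else 1 := by
  have h : Set.ncard {x | f x = g x} = (Finset.univ.filter fun x => f x = g x).card := by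
    rw [← Set.ncard_coe_finset]
    simp
  rw [Finset.prod_ite, Finset.prod_const, Finset.prod_const_one, mul_one, h, mul_comm,
    Real.exp_nat_mul]

/-- Exponential moment bound for the number of agreements of a fixed function with a uniformly
random one. -/
lemma sum_exp_mul_ncard_agree_le {α β : Type*} [Fintype α] [DecidableEq α] [Fintype β]
    [Nonempty β] (t : ℝ) (f : α → β) :
    ∑ g : α → β, Real.exp (t * (Set.ncard {x | f x = g x} : ℝ)) ≤
      (Fintype.card β : ℝ) ^ Fintype.card α *
        Real.exp (Real.exp t * (Fintype.card α : ℝ) / (Fintype.card β : ℝ)) := by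
  classical
  have hq : (0 : ℝ) < Fintype.card β := by exact_mod_cast Fintype.card_pos
  have hone (x : α) : ∑ y : β, (if f x = y then Real.exp t else 1) ≤
      Fintype.card β * Real.exp (Real.exp t / Fintype.card β) := by
    calc ∑ y : β, (if f x = y then Real.exp t else 1)
        ≤ ∑ y : β, ((if f x = y then Real.exp t else 0) + 1) := by
          gcongr with y
          split_ifs <;> simp
      _ = Fintype.card β * (Real.exp t / Fintype.card β + 1) := by
          simp only [Finset.sum_add_distrib, Finset.sum_ite_eq, Finset.mem_univ, if_true,
            Finset.sum_const, Finset.card_univ, nsmul_eq_mul]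
          field_simp
      _ ≤ _ := by
          gcongr
          exact Real.add_one_le_exp _
  calc ∑ g : α → β, Real.exp (t * (Set.ncard {x | f x = g x} : ℝ))
      = ∏ x, ∑ y : β, (if f x = y then Real.exp t else 1) := by
        simp only [exp_mul_ncard_agree, Finset.prod_univ_sum, Fintype.piFinset_univ]
    _ ≤ ∏ _x : α, (Fintype.card β * Real.exp (Real.exp t / Fintype.card β) : ℝ) := by
        refine Finset.prod_le_prod (fun x _ => Finset.sum_nonneg fun y _ => ?_) fun x _ => hone x
        split_ifs <;> positivity
    _ = _ := by
        rw [Finset.prod_const, Finset.card_univ, mul_pow, ← Real.exp_nat_mul]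
        congr 2
        ring

/-- Counting lemma: if `F` is a set of at most `|M₂|^c` functions `M₁ → M₂` with
`|M₂| ≥ 2`, then some function `g : M₁ → M₂` agrees with each `f ∈ F` on at most
`max (e² |M₁| / |M₂|) (c log |M₂| + log |M₁|)` points. -/
theorem stmt_18 {M₁ M₂ : Type*} [Fintype M₁] [Fintype M₂]
    (h2 : 2 ≤ Fintype.card M₂) (F : Set (M₁ → M₂)) (c : ℝ) (hc : 0 < c)
    (hF : (F.ncard : ℝ) ≤ (Fintype.card M₂ : ℝ) ^ c) :
    ∃ g : M₁ → M₂, ∀ f ∈ F,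
      (Set.ncard {x | f x = g x} : ℝ) ≤
        max (Real.exp 1 ^ 2 * (Fintype.card M₁ : ℝ) / (Fintype.card M₂ : ℝ))
          (c * Real.log (Fintype.card M₂) + Real.log (Fintype.card M₁)) := by
  classical
  by_contra! hbad
  have : Nonempty M₂ := Fintype.card_pos_iff.mp (by omega)
  have hq : (0 : ℝ) < Fintype.card M₂ := by exact_mod_cast Fintype.card_pos
  set n := Fintype.card M₁
  set q := Fintype.card M₂
  set T := max (Real.exp 1 ^ 2 * (n : ℝ) / (q : ℝ)) (c * Real.log q + Real.log n) with hT
  have hlower : (q : ℝ) ^ n * Real.exp (2 * T) <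
      ∑ g : M₁ → M₂, ∑ f ∈ F.toFinset, Real.exp (2 * (Set.ncard {x | f x = g x} : ℝ)) := by
    have hcard : (q : ℝ) ^ n * Real.exp (2 * T) = ∑ _g : M₁ → M₂, Real.exp (2 * T) := by
      simp [q, n]
    rw [hcard]
    refine Finset.sum_lt_sum_of_nonempty Finset.univ_nonempty fun g _ => ?_
    obtain ⟨f, hf, hfg⟩ := hbad g
    calc Real.exp (2 * T) < Real.exp (2 * (Set.ncard {x | f x = g x} : ℝ)) :=
          Real.exp_lt_exp.mpr (by linarith)
      _ ≤ _ := Finset.single_le_sum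
          (f := fun f : M₁ → M₂ => Real.exp (2 * (Set.ncard {x | f x = g x} : ℝ)))
          (fun _ _ => (Real.exp_pos _).le) (Set.mem_toFinset.mpr hf)
  have hupper : ∑ g : M₁ → M₂, ∑ f ∈ F.toFinset,
      Real.exp (2 * (Set.ncard {x | f x = g x} : ℝ)) ≤
      (q : ℝ) ^ c * ((q : ℝ) ^ n * Real.exp (Real.exp 2 * (n : ℝ) / (q : ℝ))) := by
    rw [Finset.sum_comm]
    refine (Finset.sum_le_card_nsmul _ _ _ fun f _ => sum_exp_mul_ncard_agree_le 2 f).trans ?_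
    rw [nsmul_eq_mul, ← Set.ncard_eq_toFinset_card']
    gcongr
  have hexp : (q : ℝ) ^ c * Real.exp (Real.exp 2 * (n : ℝ) / (q : ℝ)) ≤ Real.exp (2 * T) := by
    have he : Real.exp 1 ^ 2 = Real.exp 2 := by
      rw [← Real.exp_nat_mul]
      norm_num
    rw [Real.rpow_def_of_pos hq, ← Real.exp_add, Real.exp_le_exp, ← he]
    have h₁ : Real.exp 1 ^ 2 * (n : ℝ) / (q : ℝ) ≤ T := le_max_left _ _
    have h₂ : c * Real.log q + Real.log n ≤ T := le_max_right _ _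
    have h₃ : 0 ≤ Real.log n := Real.log_natCast_nonneg n
    linarith
  have := mul_le_mul_of_nonneg_left hexp (pow_pos hq n).le
  linarith
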